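/- arXiv:2601.08576 — 6 statements merged into one kernel-verified Lean document; each statement's English description precedes it below -/
import Mathlib

section
/- Let A be a commutative ring, let {·,·} be a Poisson bracket on A, and let u ∈ A be a unit. Define {f,g}_u := u⁻¹{u·f, u·g}. Then {·,·}_u is a first-order differential operator in each argument; explicitly, {h·f, g}_u = h·{f,g}_u + f·{h,g}_u − h·f·{1,g}_u for all f, g, h ∈ A. (Together with the Jacobi identity, this shows the conformally rescaled Poisson bracket of Theorem 2.1 is a Jacobi bracket.) -/
/-- The conformal rescaling `{f,g}_u := u⁻¹ {u·f, u·g}` of a Poisson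
bracket is a first-order differential operator in each argument:
`{h·f, g}_u = h·{f,g}_u + f·{h,g}_u − h·f·{1,g}_u`. -/
theorem conformal_rescaled_poisson_bracket_first_order
    {A : Type*} [CommRing A]
    (P : A → A → A)
    (hadd_left : ∀ f g h : A, P (f + g) h = P f h + P g h)
    (hadd_right : ∀ f g h : A, P f (g + h) = P f g + P f h)
    (hanti : ∀ f g : A, P f g = -P g f)
    (hleib : ∀ f g h : A, P (h * f) g = h * P f g + f * P h g)
    (hjac : ∀ f g h : A, P (P f g) h + P (P g h) f + P (P h f) g = 0)
    (u : Aˣ)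
    (Pu : A → A → A)
    (hPu : ∀ f g : A, Pu f g = (↑u⁻¹ : A) * P ((↑u : A) * f) ((↑u : A) * g)) :
    ∀ f g h : A, Pu (h * f) g = h * Pu f g + f * Pu h g - h * f * Pu 1 g := by
  intro f g h
  simp only [hPu, mul_one, hleib]
  ring
end

section
/- Let B be a Nambu–Poisson 3-bracket on a commutative ring A and let u ∈ A be a unit. Define B'(f,g,h) := u⁻¹·B(u·f, u·g, u·h). Then B' is a first-order differential operator in its first argument: B'(h·f, g, k) = h·B'(f,g,k) + f·B'(h,g,k) − h·f·B'(1,g,k) for all f, g, h, k ∈ A. (Together with the fundamental identity, this establishes Theorem 4.2: the conformally rescaled Nambu–Poisson 3-bracket is a Nambu–Jacobi 3-bracket.) -/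
/-- The conformal rescaling `B'(f,g,h) := u⁻¹·B(u·f, u·g, u·h)` of a
Nambu–Poisson 3-bracket is a first-order differential operator in its first
argument: `B'(h·f, g, k) = h·B'(f,g,k) + f·B'(h,g,k) − h·f·B'(1,g,k)`. -/
theorem conformal_rescaled_nambu_poisson_three_bracket_first_order
    {A : Type*} [CommRing A]
    (B : A → A → A → A)
    (hadd1 : ∀ f f' g h : A, B (f + f') g h = B f g h + B f' g h)
    (hadd2 : ∀ f g g' h : A, B f (g + g') h = B f g h + B f g' h)
    (hadd3 : ∀ f g h h' : A, B f g (h + h') = B f g h + B f g h')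
    (halt12 : ∀ f g h : A, B f g h = -B g f h)
    (halt23 : ∀ f g h : A, B f g h = -B f h g)
    (halt13 : ∀ f g h : A, B f g h = -B h g f)
    (hder1 : ∀ f g k h : A, B (h * f) g k = h * B f g k + f * B h g k)
    (hder2 : ∀ f g k h : A, B f (h * g) k = h * B f g k + g * B f h k)
    (hder3 : ∀ f g k h : A, B f g (h * k) = h * B f g k + k * B f g h)
    (hfund : ∀ f1 f2 f3 f4 f5 : A, B f1 f2 (B f3 f4 f5) =
      B (B f1 f2 f3) f4 f5 + B f3 (B f1 f2 f4) f5 + B f3 f4 (B f1 f2 f5))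
    (u : Aˣ) (B' : A → A → A → A)
    (hB' : ∀ f g h : A,
      B' f g h = (↑u⁻¹ : A) * B ((↑u : A) * f) ((↑u : A) * g) ((↑u : A) * h)) :
    ∀ f g k h : A, B' (h * f) g k = h * B' f g k + f * B' h g k - h * f * B' 1 g k := by
  intro f g k h
  simp only [hB', mul_one, hder1 _ (↑u * g) (↑u * k)]
  ring
end

section
/- Let k ≥ 2, let B be a Nambu–Poisson k-bracket on a commutative ring A, and let u ∈ A be a unit. Define B'(f₁,…,f_k) := u⁻¹·B(u·f₁, …, u·f_k). Then B' satisfies the fundamental identity: B'(f₁,…,f_{k−1}, B'(g₁,…,g_k)) = Σ_{i=1}^{k} B'(g₁,…,g_{i−1}, B'(f₁,…,f_{k−1},g_i), g_{i+1},…,g_k) for all f₁,…,f_{k−1}, g₁,…,g_k ∈ A. (This is the algebraic core of Theorem 4.6: a locally conformally k-Nambu–Poisson manifold is a k-Nambu–Jacobi manifold.) -/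
/-- For a Nambu–Poisson `k`-bracket (`k = n + 2 ≥ 2`) and a unit `u`,
the conformal rescaling `B'(f₁,…,f_k) := u⁻¹·B(u·f₁, …, u·f_k)` satisfies the
fundamental identity. -/
theorem conformal_rescaled_nambu_poisson_k_bracket_fundamental_identity
    {A : Type*} [CommRing A] (n : ℕ)
    (B : (Fin (n + 2) → A) → A)
    (hadd : ∀ (f : Fin (n + 2) → A) (i : Fin (n + 2)) (x y : A),
      B (Function.update f i (x + y))
        = B (Function.update f i x) + B (Function.update f i y))
    (halt : ∀ (f : Fin (n + 2) → A) (i j : Fin (n + 2)), i ≠ j →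
      B (f ∘ Equiv.swap i j) = -B f)
    (hder : ∀ (f : Fin (n + 2) → A) (i : Fin (n + 2)) (x y : A),
      B (Function.update f i (x * y))
        = x * B (Function.update f i y) + y * B (Function.update f i x))
    (hfund : ∀ (f : Fin (n + 1) → A) (g : Fin (n + 2) → A),
      B (Fin.snoc f (B g))
        = ∑ i : Fin (n + 2), B (Function.update g i (B (Fin.snoc f (g i)))))
    (u : Aˣ) (B' : (Fin (n + 2) → A) → A)
    (hB' : ∀ f : Fin (n + 2) → A, B' f = (↑u⁻¹ : A) * B (fun j => (↑u : A) * f j)) :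
    ∀ (f : Fin (n + 1) → A) (g : Fin (n + 2) → A),
      B' (Fin.snoc f (B' g))
        = ∑ i : Fin (n + 2), B' (Function.update g i (B' (Fin.snoc f (g i)))) := by
  intro f g
  have hsnoc : ∀ x : A, B' (Fin.snoc f x)
      = (↑u⁻¹ : A) * B (Fin.snoc (fun j => (↑u : A) * f j) ((↑u : A) * x)) := by
    intro x
    rw [hB']
    congr 2
    funext j
    refine Fin.lastCases ?_ (fun j => ?_) j <;> simp
  have hupdate : ∀ (i : Fin (n + 2)) (x : A), B' (Function.update g i x)
      = (↑u⁻¹ : A) * B (Function.update (fun j => (↑u : A) * g j) i ((↑u : A) * x)) := by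
    intro i x
    rw [hB']
    congr 2
    funext j
    by_cases h : j = i
    · subst h; simp
    · simp [h]
  simp only [hsnoc, hupdate, hB' g, Units.mul_inv_cancel_left, hfund, Finset.mul_sum]
end

section
/- Let k ≥ 2 and let B be a Nambu–Poisson k-bracket on a commutative ring A. For a (k−1)-tuple H = (H₁,…,H_{k−1}) of elements of A, define the Hamiltonian operator X_H : A → A by X_H(f) := B(f, H₁, …, H_{k−1}). Then for all tuples H = (H₁,…,H_{k−1}) and F = (F₁,…,F_{k−1}) and all f ∈ A: X_H(X_F(f)) − X_F(X_H(f)) = (−1)^{k−1} Σ_{i=1}^{k−1} X_{(F₁,…,F_{i−1}, B(H₁,…,H_{k−1},F_i), F_{i+1},…,F_{k−1})}(f). (This is the paper's involutivity formula (3.12) for the characteristic distribution generated by Nambu Hamiltonian vector fields; for k = 2 it reduces to [X_{H₁}, X_{H₂}] = −X_{{H₁,H₂}}.) -/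
/-- A function of `m` variables that changes sign under swaps is multiplied by the sign under
an arbitrary permutation of its variables. -/
theorem map_comp_perm_of_map_comp_swap {A : Type*} [CommRing A] {m : ℕ} (B : (Fin m → A) → A)
    (halt : ∀ (f : Fin m → A) (i j : Fin m), i ≠ j → B (f ∘ Equiv.swap i j) = -B f)
    (σ : Equiv.Perm (Fin m)) (g : Fin m → A) :
    B (g ∘ σ) = ((Equiv.Perm.sign σ : ℤ) : A) * B g := by
  induction σ using Equiv.Perm.swap_induction_on generalizing g with
  | one => simp
  | swap_mul τ x y hxy ih =>
    rw [Equiv.Perm.coe_mul, ← Function.comp_assoc, ih, halt g x y hxy, Equiv.Perm.sign_mul,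
      Equiv.Perm.sign_swap hxy]
    simp

/-- Moving the last argument of an alternating function of `m + 1` variables to the front
multiplies it by `(-1) ^ m`. -/
theorem map_snoc_of_map_comp_swap {A : Type*} [CommRing A] {m : ℕ} (B : (Fin (m + 1) → A) → A)
    (halt : ∀ (f : Fin (m + 1) → A) (i j : Fin (m + 1)), i ≠ j →
      B (f ∘ Equiv.swap i j) = -B f)
    (H : Fin m → A) (f : A) :
    B (Fin.snoc H f) = (-1 : A) ^ m * B (Fin.cons f H) := by
  have h : (Fin.snoc H f : Fin (m + 1) → A) = (Fin.cons f H : Fin (m + 1) → A) ∘ finRotate _ :=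
    Fin.snoc_eq_cons_rotate H f
  rw [h, map_comp_perm_of_map_comp_swap B halt, sign_finRotate]
  simp


/-- Involutivity of Nambu Hamiltonian operators. For a Nambu–Poisson
`k`-bracket (`k = n + 2 ≥ 2`), with `X_H(f) := B(f, H₁, …, H_{k−1})`, one has
`X_H(X_F(f)) − X_F(X_H(f))
  = (−1)^{k−1} Σᵢ X_{(F₁,…,F_{i−1}, B(H₁,…,H_{k−1},F_i), F_{i+1},…,F_{k−1})}(f)`. -/
theorem nambu_poisson_hamiltonian_operators_involutive
    {A : Type*} [CommRing A] (n : ℕ)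
    (B : (Fin (n + 2) → A) → A)
    (hadd : ∀ (f : Fin (n + 2) → A) (i : Fin (n + 2)) (x y : A),
      B (Function.update f i (x + y))
        = B (Function.update f i x) + B (Function.update f i y))
    (halt : ∀ (f : Fin (n + 2) → A) (i j : Fin (n + 2)), i ≠ j →
      B (f ∘ Equiv.swap i j) = -B f)
    (hder : ∀ (f : Fin (n + 2) → A) (i : Fin (n + 2)) (x y : A),
      B (Function.update f i (x * y))
        = x * B (Function.update f i y) + y * B (Function.update f i x))
    (hfund : ∀ (f : Fin (n + 1) → A) (g : Fin (n + 2) → A),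
      B (Fin.snoc f (B g))
        = ∑ i : Fin (n + 2), B (Function.update g i (B (Fin.snoc f (g i)))))
    (X : (Fin (n + 1) → A) → A → A)
    (hX : ∀ (H : Fin (n + 1) → A) (f : A), X H f = B (Fin.cons f H)) :
    ∀ (H F : Fin (n + 1) → A) (f : A),
      X H (X F f) - X F (X H f)
        = (-1 : A) ^ (n + 1) *
            ∑ i : Fin (n + 1), X (Function.update F i (B (Fin.snoc H (F i)))) f := by
  intro H F f
  have hneg : ∀ x, B (Fin.cons (-x) F) = -B (Fin.cons x F) := by
    let φ : A →+ A := AddMonoidHom.mk' (fun x => B (Fin.cons x F)) fun x y => by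
      simpa using hadd (Fin.cons 0 F) 0 x y
    exact fun x => map_neg φ x
  have hfund' := hfund H (Fin.cons f F)
  rw [Fin.sum_univ_succ] at hfund'
  simp only [Fin.cons_zero, Fin.cons_succ, Fin.update_cons_zero, ← Fin.cons_update] at hfund'
  rw [map_snoc_of_map_comp_swap B halt H (B _), map_snoc_of_map_comp_swap B halt H f] at hfund'
  simp only [hX]
  rcases neg_one_pow_eq_or A (n + 1) with hs | hs
  · rw [hs] at hfund' ⊢
    simp only [one_mul] at hfund' ⊢
    rw [hfund']
    ring
  · rw [hs] at hfund' ⊢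
    simp only [neg_one_mul, hneg] at hfund' ⊢
    linear_combination -hfund'
end

section
/- Let p ≥ 1, let B be a generalized Poisson 2p-bracket on a commutative ring A, and let u ∈ A be a unit. Define B'(f₁,…,f_{2p}) := u⁻¹·B(u·f₁, …, u·f_{2p}). Then B' satisfies the generalized Jacobi identity: Σ_{σ ∈ S_{4p−1}} sgn(σ) · B'(f_{σ(1)},…,f_{σ(2p−1)}, B'(f_{σ(2p)},…,f_{σ(4p−1)})) = 0 for all f₁,…,f_{4p−1} ∈ A. (This is the algebraic core of Theorem 5.1: a locally conformally 2p-generalized Poisson manifold is a 2p-generalized Jacobi manifold; on each chart the glued bracket equals e^{σ}{e^{−σ}F¹,…,e^{−σ}F^{2p}}_α.) -/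
/-- For a generalized Poisson `2p`-bracket (`p = q + 1 ≥ 1`) and a
unit `u`, the conformal rescaling `B'(f₁,…,f_{2p}) := u⁻¹·B(u·f₁, …, u·f_{2p})`
satisfies the generalized Jacobi identity
`Σ_{σ ∈ S_{4p−1}} sgn(σ)·B'(f_{σ(1)},…,f_{σ(2p−1)}, B'(f_{σ(2p)},…,f_{σ(4p−1)})) = 0`. -/
theorem conformal_rescaled_generalized_poisson_bracket_generalized_jacobi
    {A : Type*} [CommRing A] (q : ℕ)
    (B : (Fin (2 * q + 2) → A) → A)
    (hadd : ∀ (f : Fin (2 * q + 2) → A) (i : Fin (2 * q + 2)) (x y : A),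
      B (Function.update f i (x + y))
        = B (Function.update f i x) + B (Function.update f i y))
    (halt : ∀ (f : Fin (2 * q + 2) → A) (i j : Fin (2 * q + 2)), i ≠ j →
      B (f ∘ Equiv.swap i j) = -B f)
    (hder : ∀ (f : Fin (2 * q + 2) → A) (i : Fin (2 * q + 2)) (x y : A),
      B (Function.update f i (x * y))
        = x * B (Function.update f i y) + y * B (Function.update f i x))
    (hGJ : ∀ f : Fin (2 * q + 1 + (2 * q + 2)) → A,
      ∑ σ : Equiv.Perm (Fin (2 * q + 1 + (2 * q + 2))),
        ((Equiv.Perm.sign σ : ℤ) : ℤ) •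
          B (Fin.snoc (fun j : Fin (2 * q + 1) => f (σ (Fin.castAdd (2 * q + 2) j)))
              (B (fun j : Fin (2 * q + 2) => f (σ (Fin.natAdd (2 * q + 1) j))))) = 0)
    (u : Aˣ) (B' : (Fin (2 * q + 2) → A) → A)
    (hB' : ∀ f : Fin (2 * q + 2) → A,
      B' f = (↑u⁻¹ : A) * B (fun j => (↑u : A) * f j)) :
    ∀ f : Fin (2 * q + 1 + (2 * q + 2)) → A,
      ∑ σ : Equiv.Perm (Fin (2 * q + 1 + (2 * q + 2))),
        ((Equiv.Perm.sign σ : ℤ) : ℤ) •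
          B' (Fin.snoc (fun j : Fin (2 * q + 1) => f (σ (Fin.castAdd (2 * q + 2) j)))
              (B' (fun j : Fin (2 * q + 2) => f (σ (Fin.natAdd (2 * q + 1) j))))) = 0 := by
  intro f
  have hsnoc (x : Fin (2 * q + 1) → A) (y : A) :
      (fun j : Fin (2 * q + 2) => (↑u : A) * (Fin.snoc x (↑u⁻¹ * y) : Fin (2 * q + 2) → A) j)
        = Fin.snoc (fun j => ↑u * x j) y := by
    funext j
    refine Fin.lastCases ?_ (fun k => ?_) j
    · simp only [Fin.snoc_last, Units.mul_inv_cancel_left]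
    · simp only [Fin.snoc_castSucc]
  simp only [hB', hsnoc]
  simpa only [Finset.mul_sum, mul_smul_comm, mul_zero] using
    congrArg ((↑u⁻¹ : A) * ·) (hGJ fun j => ↑u * f j)
end

section
/- Let p ≥ 1, let B be a generalized Poisson 2p-bracket on a commutative ring A, and let u ∈ A be a unit. Define B'(f₁,…,f_{2p}) := u⁻¹·B(u·f₁, …, u·f_{2p}). Then B' is a first-order differential operator in its first argument: B'(h·f₁, f₂, …, f_{2p}) = h·B'(f₁,…,f_{2p}) + f₁·B'(h, f₂, …, f_{2p}) − h·f₁·B'(1, f₂, …, f_{2p}) for all h, f₁, …, f_{2p} ∈ A. (This is the first-order operator axiom GJ2 for the conformally rescaled generalized Poisson bracket, part of Theorem 5.1 showing the rescaled bracket is a generalized Jacobi 2p-bracket.) -/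
/-- For a generalized Poisson `2p`-bracket (`p = q + 1 ≥ 1`) and a
unit `u`, the conformal rescaling `B'(f₁,…,f_{2p}) := u⁻¹·B(u·f₁, …, u·f_{2p})`
is a first-order differential operator in its first argument:
`B'(h·f₁, f₂,…,f_{2p}) = h·B'(f₁,…,f_{2p}) + f₁·B'(h, f₂,…,f_{2p})
  − h·f₁·B'(1, f₂,…,f_{2p})`. -/
theorem conformal_rescaled_generalized_poisson_bracket_first_order
    {A : Type*} [CommRing A] (q : ℕ)
    (B : (Fin (2 * q + 2) → A) → A)
    (hadd : ∀ (f : Fin (2 * q + 2) → A) (i : Fin (2 * q + 2)) (x y : A),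
      B (Function.update f i (x + y))
        = B (Function.update f i x) + B (Function.update f i y))
    (halt : ∀ (f : Fin (2 * q + 2) → A) (i j : Fin (2 * q + 2)), i ≠ j →
      B (f ∘ Equiv.swap i j) = -B f)
    (hder : ∀ (f : Fin (2 * q + 2) → A) (i : Fin (2 * q + 2)) (x y : A),
      B (Function.update f i (x * y))
        = x * B (Function.update f i y) + y * B (Function.update f i x))
    (hGJ : ∀ f : Fin (2 * q + 1 + (2 * q + 2)) → A,
      ∑ σ : Equiv.Perm (Fin (2 * q + 1 + (2 * q + 2))),
        ((Equiv.Perm.sign σ : ℤ) : ℤ) •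
          B (Fin.snoc (fun j : Fin (2 * q + 1) => f (σ (Fin.castAdd (2 * q + 2) j)))
              (B (fun j : Fin (2 * q + 2) => f (σ (Fin.natAdd (2 * q + 1) j))))) = 0)
    (u : Aˣ) (B' : (Fin (2 * q + 2) → A) → A)
    (hB' : ∀ f : Fin (2 * q + 2) → A,
      B' f = (↑u⁻¹ : A) * B (fun j => (↑u : A) * f j)) :
    ∀ (h x : A) (f : Fin (2 * q + 1) → A),
      B' (Fin.cons (h * x) f)
        = h * B' (Fin.cons x f) + x * B' (Fin.cons h f)
          - h * x * B' (Fin.cons (1 : A) f) := by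
  intro h x f
  have hcons : ∀ a : A, (fun j => (↑u : A) * (Fin.cons a f : Fin (2 * q + 2) → A) j)
      = Fin.cons (↑u * a) (fun j => ↑u * f j) := by
    intro a
    funext j
    refine Fin.cases ?_ (fun k => ?_) j <;> simp
  have hmul : ∀ a b : A, B (Fin.cons (a * b) (fun j => ↑u * f j))
      = a * B (Fin.cons b (fun j => ↑u * f j)) + b * B (Fin.cons a (fun j => ↑u * f j)) := by
    intro a b
    simpa only [Fin.update_cons_zero] using hder (Fin.cons 0 (fun j => ↑u * f j)) 0 a b
  rw [hB', hB', hB', hB', hcons, hcons, hcons, hcons, mul_one, hmul, hmul h x, hmul _ x, hmul _ h]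
  ring
end
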